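/- Let Ω ⊂ ℝ² be open and let u : Ω → ℝ be a C³ function with ∇u(x) ≠ 0 for every x ∈ Ω, and set q(x) = |∇u(x)|. Then at every point of Ω: Σ_{i,h=1}^2 (u_{ih})² = (Δu)² + 2|∇q|² − (2Δu/q) ⟨∇q, ∇u⟩. -/

import Mathlib

open Set
open scoped RealInnerProductSpace

noncomputable section

/-- The `i`-th standard basis vector of `ℝ²`. -/
def eb (i : Fin 2) : EuclideanSpace ℝ (Fin 2) := EuclideanSpace.single i 1

/-- Second partial derivative `u_{ih} = ∂²u/∂x^i∂x^h`. -/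
def pd2 (u : EuclideanSpace ℝ (Fin 2) → ℝ) (x : EuclideanSpace ℝ (Fin 2))
    (i h : Fin 2) : ℝ :=
  fderiv ℝ (fun y => fderiv ℝ u y (eb h)) x (eb i)

/-- The Laplacian `Δu = u_{11} + u_{22}`. -/
def lap (u : EuclideanSpace ℝ (Fin 2) → ℝ) (x : EuclideanSpace ℝ (Fin 2)) : ℝ :=
  ∑ i, pd2 u x i i

/-- The gradient modulus `q = |∇u|`. -/
def qf (u : EuclideanSpace ℝ (Fin 2) → ℝ) (x : EuclideanSpace ℝ (Fin 2)) : ℝ :=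
  ‖gradient u x‖

/-- The coordinates of the gradient are the partial derivatives. -/
theorem gradient_apply_eq_fderiv_eb (f : EuclideanSpace ℝ (Fin 2) → ℝ)
    (x : EuclideanSpace ℝ (Fin 2)) (i : Fin 2) : gradient f x i = fderiv ℝ f x (eb i) := by
  have h : ⟪gradient f x, eb i⟫ = fderiv ℝ f x (eb i) := by
    simp [gradient]
  rw [← h, eb, EuclideanSpace.inner_single_right]
  simp

theorem norm_gradient_sq (f : EuclideanSpace ℝ (Fin 2) → ℝ) (x : EuclideanSpace ℝ (Fin 2)) :
    ‖gradient f x‖ ^ 2 = fderiv ℝ f x (eb 0) ^ 2 + fderiv ℝ f x (eb 1) ^ 2 := by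
  simp [EuclideanSpace.norm_sq_eq, gradient_apply_eq_fderiv_eb]

theorem differentiableAt_fderiv_apply {u : EuclideanSpace ℝ (Fin 2) → ℝ}
    {x : EuclideanSpace ℝ (Fin 2)} (hu : ContDiffAt ℝ 2 u x) (v : EuclideanSpace ℝ (Fin 2)) :
    DifferentiableAt ℝ (fun y => fderiv ℝ u y v) x :=
  ((hu.fderiv_right (m := 1) (by norm_num)).differentiableAt (by norm_num)).clm_apply
    (differentiableAt_const v)

theorem pd2_comm {u : EuclideanSpace ℝ (Fin 2) → ℝ} {x : EuclideanSpace ℝ (Fin 2)}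
    (hu : ContDiffAt ℝ 2 u x) (i h : Fin 2) : pd2 u x i h = pd2 u x h i := by
  have hd : DifferentiableAt ℝ (fderiv ℝ u) x :=
    (hu.fderiv_right (m := 1) (by norm_num)).differentiableAt (by norm_num)
  have key (j k : Fin 2) : pd2 u x j k = fderiv ℝ (fderiv ℝ u) x (eb j) (eb k) := by
    simp [pd2, fderiv_clm_apply hd (differentiableAt_const (eb k))]
  rw [key, key]
  exact hu.isSymmSndFDerivAt (by simp) (eb i) (eb h)

/-- `q ∂ᵢq = Σ_h ∂_h u · u_{ih}`. -/
theorem qf_mul_fderiv_qf {u : EuclideanSpace ℝ (Fin 2) → ℝ} {x : EuclideanSpace ℝ (Fin 2)}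
    (hu : ContDiffAt ℝ 2 u x) (hx : gradient u x ≠ 0) (i : Fin 2) :
    qf u x * fderiv ℝ (qf u) x (eb i) =
      fderiv ℝ u x (eb 0) * pd2 u x i 0 + fderiv ℝ u x (eb 1) * pd2 u x i 1 := by
  have hq : qf u = fun y => √(fderiv ℝ u y (eb 0) ^ 2 + fderiv ℝ u y (eb 1) ^ 2) := by
    funext y
    rw [← norm_gradient_sq, Real.sqrt_sq (norm_nonneg _), qf]
  have hpos : 0 < qf u x := norm_pos_iff.mpr hx
  have hne : fderiv ℝ u x (eb 0) ^ 2 + fderiv ℝ u x (eb 1) ^ 2 ≠ 0 := by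
    rw [← norm_gradient_sq]
    exact pow_ne_zero 2 (norm_ne_zero_iff.mpr hx)
  have h0 := (differentiableAt_fderiv_apply hu (eb 0)).hasFDerivAt
  have h1 := (differentiableAt_fderiv_apply hu (eb 1)).hasFDerivAt
  have hd := ((h0.pow 2).add (h1.pow 2)).sqrt hne
  have hd' : HasFDerivAt (qf u) _ x := hq ▸ hd
  have hqx : √(fderiv ℝ u x (eb 0) ^ 2 + fderiv ℝ u x (eb 1) ^ 2) = qf u x :=
    (congrFun hq x).symm
  rw [hd'.fderiv]
  simp [hqx, pd2]
  field_simp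

/-- Identity (2.24), valid in dimension `N = 2` only: for a `C³` function `u` with
nonvanishing gradient on an open set `Ω ⊂ ℝ²` and `q = |∇u|`,
`Σ_{i,h} u_{ih}² = (Δu)² + 2|∇q|² − (2Δu/q)⟨∇q, ∇u⟩` at every point of `Ω`. -/
theorem stmt9 (Ω : Set (EuclideanSpace ℝ (Fin 2))) (hΩ : IsOpen Ω)
    (u : EuclideanSpace ℝ (Fin 2) → ℝ) (hu : ContDiffOn ℝ 3 u Ω)
    (hgrad : ∀ x ∈ Ω, gradient u x ≠ 0) :
    ∀ x ∈ Ω,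
      ∑ i, ∑ h, (pd2 u x i h)^2 =
        (lap u x)^2 + 2 * ‖gradient (qf u) x‖^2
          - (2 * lap u x / qf u x) * ⟪gradient (qf u) x, gradient u x⟫ := by
  intro x hx
  have h2 : ContDiffAt ℝ 2 u x := (hu.contDiffAt (hΩ.mem_nhds hx)).of_le (by norm_num)
  have hpos : 0 < qf u x := norm_pos_iff.mpr (hgrad x hx)
  have hq2 : qf u x ^ 2 = _ := norm_gradient_sq u x
  have e0 := qf_mul_fderiv_qf h2 (hgrad x hx) 0
  have e1 := qf_mul_fderiv_qf h2 (hgrad x hx) 1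
  have hin : ⟪gradient (qf u) x, gradient u x⟫ =
      fderiv ℝ (qf u) x (eb 0) * fderiv ℝ u x (eb 0) +
        fderiv ℝ (qf u) x (eb 1) * fderiv ℝ u x (eb 1) := by
    rw [PiLp.inner_apply]
    simp [gradient_apply_eq_fderiv_eb, mul_comm]
  rw [hin, norm_gradient_sq]
  simp only [lap, Fin.sum_univ_two]
  rw [pd2_comm h2 1 0] at e1 ⊢
  generalize pd2 u x 0 0 = a at *
  generalize pd2 u x 0 1 = b at *
  generalize pd2 u x 1 1 = c at *
  generalize fderiv ℝ u x (eb 0) = p at *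
  generalize fderiv ℝ u x (eb 1) = r at *
  generalize qf u x = q at *
  rw [mul_comm, ← eq_div_iff hpos.ne'] at e0 e1
  rw [e0, e1]
  field_simp
  rw [hq2]
  ring

end
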